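/- Let s, t : ℕ → ℕ be sequences with s nonincreasing (s(p+1) ≤ s(p) for all p), t nondecreasing (t(p) ≤ t(p+1) for all p), and s(p) ≤ 1 for all p. Define r : ℕ → ℤ by r(p) = t(p) + 3 − s(p). Suppose r(p) < r(p+1) for p = 0,1,2,3, r(4) = r(5), and r(5) ≤ 6. Then r(p) = p + 2 for 0 ≤ p ≤ 4, r(5) = 6, s(0) = 1, t(0) = 0, and exactly one of the following holds: either s(1) = 0, in which case s(p) = 0 for 1 ≤ p ≤ 5 and (t(0),…,t(5)) = (0,0,1,2,3,3); or s(1) = 1 and t(1) = 1. -/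

import Mathlib

/-- A 4th-order three-dimensional Lorentz geometry is either properly CH₁
(rank sequences `s = (1,0,0,0,0,0)`, `t = (0,0,1,2,3,3)`) or properly CH₀ with
first-order pseudo-stabilization (`s 1 = 1`, `t 1 = 1`). -/
theorem fourth_order_dichotomy (s t : ℕ → ℕ)
    (hs_mono : ∀ p, s (p + 1) ≤ s p)
    (ht_mono : ∀ p, t p ≤ t (p + 1))
    (hs_le : ∀ p, s p ≤ 1)
    (r : ℕ → ℤ)
    (hr : ∀ p, r p = (t p : ℤ) + 3 - (s p : ℤ))
    (hstrict : ∀ p ≤ 3, r p < r (p + 1))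
    (hstab : r 4 = r 5)
    (hbound : r 5 ≤ 6) :
    (∀ p ≤ 4, r p = (p : ℤ) + 2) ∧ r 5 = 6 ∧ s 0 = 1 ∧ t 0 = 0 ∧
      Xor'
        (s 1 = 0 ∧ (∀ p, 1 ≤ p → p ≤ 5 → s p = 0) ∧
          t 0 = 0 ∧ t 1 = 0 ∧ t 2 = 1 ∧ t 3 = 2 ∧ t 4 = 3 ∧ t 5 = 3)
        (s 1 = 1 ∧ t 1 = 1) := by
  have hs₀ := hs_mono 0
  have hs₁ := hs_mono 1
  have hs₂ := hs_mono 2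
  have hs₃ := hs_mono 3
  have hs₄ := hs_mono 4
  have ht₀ := ht_mono 0
  have hle₀ := hs_le 0
  have hle₁ := hs_le 1
  have hr₀ := hr 0
  have hr₁ := hr 1
  have hr₂ := hr 2
  have hr₃ := hr 3
  have hr₄ := hr 4
  have hr₅ := hr 5
  have hlt₀ := hstrict 0 (by norm_num)
  have hlt₁ := hstrict 1 (by norm_num)
  have hlt₂ := hstrict 2 (by norm_num)
  have hlt₃ := hstrict 3 (by norm_num)
  norm_num only at hs₀ hs₁ hs₂ hs₃ hs₄ ht₀ hlt₀ hlt₁ hlt₂ hlt₃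
  refine ⟨fun p hp => ?_, by omega, by omega, by omega, ?_⟩
  · interval_cases p <;> push_cast <;> omega
  · rcases Nat.le_one_iff_eq_zero_or_eq_one.mp hle₁ with h | h
    · refine Or.inl ⟨⟨h, fun p hp₁ hp₅ => ?_, by omega, by omega, by omega, by omega,
        by omega, by omega⟩, by omega⟩
      interval_cases p <;> omega
    · exact Or.inr ⟨⟨h, by omega⟩, by omega⟩
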